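/- Let Γ be a round tree graph with horizontal branching in [2,H] and vertical branching V ≥ 2, and set Q = 1 + log V / log H. Then for every p with 1 ≤ p < Q there exist c > 0 and r_0 ≥ 1 such that for all r ≥ r_0, Λ^p_Γ(r) ≥ c·r^{(pQ − p)/(pQ − p + Q)}. In particular, taking p = 1, there exist c > 0 and r_0 ≥ 1 such that Λ^1_Γ(r) ≥ c·r^{(Q−1)/(2Q−1)} for all r ≥ r_0. -/

import Mathlib

open Finset

/-- Vertices of a round tree graph: pairs of a word over `[H] = {0,…,H-1}` and a word
over `[V] = {0,…,V-1}`. -/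
abbrev RTVert (H V : ℕ) := List (Fin H) × List (Fin V)

/-- Strict lexicographic order on words (over `Fin n`). -/
def LexLt {n : ℕ} (w w' : List (Fin n)) : Prop := List.Lex (· < ·) w w'

/-- `Γ` is a round tree graph with vertical branching `V` and horizontal branching in
`[2,H]`, with vertex set `S ⊆ [H]^* × [V]^*`:
(0) `(∅,∅) ∈ S`;
(1) `|h| = |v|` for every `(h,v) ∈ S`;
(2) if `(hα, vβ) ∈ S` then `(h,v) ∈ S` and they are joined by a (vertical) edge;
(3) for `(h,v) ∈ S` and `β ∈ [V]` there is `Δ ∈ [2,H]` with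
    `{α : (hα,vβ) ∈ S} = [Δ]`;
(4) if `(h,v),(h',v) ∈ S` with `h,h'` consecutive in the lexicographic order on
    `{w : (w,v) ∈ S}`, they are joined by a (horizontal) edge;
(5) every edge of `Γ` is vertical or horizontal as above. -/
def IsRoundTreeGraph (H V : ℕ) (S : Set (RTVert H V)) (Γ : SimpleGraph (RTVert H V)) :
    Prop :=
  (([], []) ∈ S) ∧
  (∀ x ∈ S, x.1.length = x.2.length) ∧
  (∀ (h : List (Fin H)) (v : List (Fin V)) (α : Fin H) (β : Fin V),
      (h ++ [α], v ++ [β]) ∈ S → (h, v) ∈ S ∧ Γ.Adj (h, v) (h ++ [α], v ++ [β])) ∧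
  (∀ (h : List (Fin H)) (v : List (Fin V)), (h, v) ∈ S → ∀ β : Fin V,
      ∃ Δ : ℕ, 2 ≤ Δ ∧ Δ ≤ H ∧
        ∀ α : Fin H, ((h ++ [α], v ++ [β]) ∈ S ↔ (α : ℕ) < Δ)) ∧
  (∀ (h h' : List (Fin H)) (v : List (Fin V)),
      (h, v) ∈ S → (h', v) ∈ S → LexLt h h' →
      (¬∃ w, (w, v) ∈ S ∧ LexLt h w ∧ LexLt w h') →
      Γ.Adj (h, v) (h', v)) ∧
  (∀ x y : RTVert H V, Γ.Adj x y → x ∈ S ∧ y ∈ S ∧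
      ((∃ (α : Fin H) (β : Fin V), y = (x.1 ++ [α], x.2 ++ [β])) ∨
       (∃ (α : Fin H) (β : Fin V), x = (y.1 ++ [α], y.2 ++ [β])) ∨
       (x.2 = y.2 ∧
        ((LexLt x.1 y.1 ∧ ¬∃ w, (w, x.2) ∈ S ∧ LexLt x.1 w ∧ LexLt w y.1) ∨
         (LexLt y.1 x.1 ∧ ¬∃ w, (w, x.2) ∈ S ∧ LexLt y.1 w ∧ LexLt w x.1)))))

/-- The `ℓ^p` norm of a function on a finite vertex set. -/
noncomputable def lpNorm {W : Type*} [Fintype W] (p : ℝ) (f : W → ℝ) : ℝ :=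
  (∑ v, |f v| ^ p) ^ (1 / p)

/-- The `ℓ^p` norm of the gradient of `f` on a finite simple graph. -/
noncomputable def gradLpNorm {W : Type*} [Fintype W] (G : SimpleGraph W) (p : ℝ)
    (f : W → ℝ) : ℝ :=
  letI := Classical.decEq W
  letI := Classical.decRel G.Adj
  (∑ e ∈ G.edgeFinset,
    Sym2.lift ⟨fun x y => |f x - f y| ^ p,
      fun x y => by show |f x - f y| ^ p = |f y - f x| ^ p; rw [abs_sub_comm]⟩ e) ^ (1 / p)

/-- The `L^p`-Poincaré constant
`h^p(Y) = inf { ‖∇f‖_p / ‖f‖_p : f : V(Y) → ℝ, ∑ v, f v = 0, f ≢ 0 }`. -/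
noncomputable def poincareConst {W : Type*} [Fintype W] (G : SimpleGraph W) (p : ℝ) : ℝ :=
  sInf { c : ℝ | ∃ f : W → ℝ, (∑ v, f v) = 0 ∧ f ≠ 0 ∧ c = gradLpNorm G p f / lpNorm p f }

/-- The `L^p`-Poincaré profile
`Λ^p_X(r) = sup { |Y| · h^p(Y) : Y a finite subgraph of X, |Y| ≤ r }`. -/
noncomputable def poincareProfile {W : Type*} (X : SimpleGraph W) (p : ℝ) (r : ℝ) : ℝ :=
  sSup { c : ℝ | ∃ (s : Finset W) (G : SimpleGraph s),
    (∀ u v : s, G.Adj u v → X.Adj u v) ∧ (s.card : ℝ) ≤ r ∧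
    c = (s.card : ℝ) * poincareConst G p }


/-- Words of length `k`. -/
def wordsF (V : ℕ) : ℕ → Finset (List (Fin V))
  | 0 => {[]}
  | k + 1 => (univ : Finset (Fin V)).biUnion fun β => (wordsF V k).image (List.cons β)

lemma mem_wordsF {V : ℕ} (k : ℕ) (w : List (Fin V)) : w ∈ wordsF V k ↔ w.length = k := by
  induction k generalizing w with
  | zero => simp [wordsF]
  | succ k ih =>
    cases w with
    | nil => simp [wordsF]
    | cons a w => simp [wordsF, ih]

lemma sum_wordsF_succ {V : ℕ} (k : ℕ) (φ : List (Fin V) → ℝ) :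
    ∑ w ∈ wordsF V (k + 1), φ w = ∑ β : Fin V, ∑ w ∈ wordsF V k, φ (β :: w) := by
  rw [wordsF, Finset.sum_biUnion]
  · refine Finset.sum_congr rfl fun β _ => ?_
    rw [Finset.sum_image]
    intro a _ b _ h
    exact (List.cons.inj h).2
  · intro a _ b _ hab
    rw [Function.onFun, Finset.disjoint_left]
    intro w hw hw'
    simp only [Finset.mem_image] at hw hw'
    obtain ⟨u, _, rfl⟩ := hw
    obtain ⟨u', _, h⟩ := hw'
    exact hab (List.cons.inj h).1.symm

lemma card_wordsF (V k : ℕ) : (wordsF V k).card = V ^ k := by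
  have : ((wordsF V k).card : ℝ) = (V : ℝ) ^ k := by
    induction k with
    | zero => simp [wordsF]
    | succ k ih =>
      have h := sum_wordsF_succ (V := V) k (fun _ => (1 : ℝ))
      simp only [Finset.sum_const, nsmul_eq_mul, mul_one, Finset.card_univ, Fintype.card_fin] at h
      rw [h, ih, pow_succ]; ring
  exact_mod_cast this

/-- The `p`-energy of a function on the `V`-ary tree of depth `k`. -/
noncomputable def treeE (V : ℕ) (p : ℝ) (k : ℕ) (g : List (Fin V) → ℝ) : ℝ :=
  ∑ j ∈ range k, ∑ v ∈ wordsF V j, ∑ β : Fin V, |g v - g (v ++ [β])| ^ p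

lemma treeE_nonneg (V : ℕ) (p : ℝ) (k : ℕ) (g : List (Fin V) → ℝ) : 0 ≤ treeE V p k g := by
  unfold treeE; positivity

lemma treeE_mono (V : ℕ) (p : ℝ) {j k : ℕ} (h : j ≤ k) (g : List (Fin V) → ℝ) :
    treeE V p j g ≤ treeE V p k g := by
  unfold treeE
  refine Finset.sum_le_sum_of_subset_of_nonneg (Finset.range_mono h) ?_
  intros; positivity

lemma treeE_succ (V : ℕ) (p : ℝ) (k : ℕ) (g : List (Fin V) → ℝ) :
    treeE V p (k + 1) g = ∑ β : Fin V, |g [] - g [β]| ^ p +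
      ∑ β : Fin V, treeE V p k (fun w => g (β :: w)) := by
  unfold treeE
  rw [Finset.sum_range_succ', add_comm, Finset.sum_comm (s := univ)]
  congr 1
  · simp [wordsF]
  · refine Finset.sum_congr rfl fun j _ => ?_
    rw [sum_wordsF_succ]
    rfl

lemma rpow_add_split {p t : ℝ} (hp : 1 ≤ p) (ht : 0 < t) (ht1 : t < 1) {a b : ℝ}
    (ha : 0 ≤ a) (hb : 0 ≤ b) :
    (a + b) ^ p ≤ t ^ (1 - p) * a ^ p + (1 - t) ^ (1 - p) * b ^ p := by
  have h1 : 0 < 1 - t := by linarith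
  have h := (convexOn_rpow hp).2 (x := a / t) (y := b / (1 - t))
    (Set.mem_Ici.2 (by positivity)) (Set.mem_Ici.2 (by positivity)) ht.le h1.le (by ring)
  simp only [smul_eq_mul] at h
  rw [mul_div_cancel₀ _ ht.ne', mul_div_cancel₀ _ h1.ne', Real.div_rpow ha ht.le,
    Real.div_rpow hb h1.le] at h
  rw [Real.rpow_sub ht, Real.rpow_sub h1, Real.rpow_one, Real.rpow_one]
  refine h.trans (le_of_eq ?_)
  ring

lemma tree_poincare (V : ℕ) (hV : 2 ≤ V) (p : ℝ) (hp : 1 ≤ p) :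
    ∃ C : ℝ, 1 ≤ C ∧ ∀ (k : ℕ) (g : List (Fin V) → ℝ),
      ∑ v ∈ wordsF V k, |g v - g []| ^ p ≤ C * (V : ℝ) ^ k * treeE V p k g := by
  have hV' : (2 : ℝ) ≤ V := by exact_mod_cast hV
  have hV0 : (0 : ℝ) < V := by linarith
  set t : ℝ := (V : ℝ) ^ (-(1 / p)) with ht
  have hp0 : 0 < p := by linarith
  have ht0 : 0 < t := Real.rpow_pos_of_pos hV0 _
  have ht1 : t < 1 := Real.rpow_lt_one_of_one_lt_of_neg (by linarith) (by
    have : 0 < 1 / p := by positivity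
    linarith)
  have htV : t ^ (1 - p) ≤ V := by
    rw [ht, ← Real.rpow_mul hV0.le]
    calc (V : ℝ) ^ (-(1 / p) * (1 - p)) ≤ (V : ℝ) ^ (1 : ℝ) := by
          apply Real.rpow_le_rpow_of_exponent_le (by linarith)
          have : -(1 / p) * (1 - p) = 1 - 1 / p := by field_simp; ring
          rw [this]
          have : 0 < 1 / p := by positivity
          linarith
      _ = V := Real.rpow_one _
  have hC : 1 ≤ (1 - t) ^ (1 - p) :=
    Real.one_le_rpow_of_pos_of_le_one_of_nonpos (by linarith) (by linarith) (by linarith)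
  refine ⟨(1 - t) ^ (1 - p), hC, ?_⟩
  set C : ℝ := (1 - t) ^ (1 - p) with hCdef
  intro k
  induction k with
  | zero => intro g; simp [wordsF, treeE, Real.zero_rpow hp0.ne']
  | succ k ih =>
    intro g
    rw [sum_wordsF_succ, treeE_succ, mul_add, Finset.mul_sum, Finset.mul_sum,
      ← Finset.sum_add_distrib]
    refine Finset.sum_le_sum fun β _ => ?_
    have hk := ih (fun w => g (β :: w))
    have hT := treeE_nonneg V p k (fun w => g (β :: w))
    have hstep : ∀ v ∈ wordsF V k, |g (β :: v) - g []| ^ p ≤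
        t ^ (1 - p) * |g (β :: v) - g [β]| ^ p + C * |g [] - g [β]| ^ p := by
      intro v _
      refine le_trans ?_ (rpow_add_split hp ht0 ht1 (abs_nonneg _) (abs_nonneg _))
      apply Real.rpow_le_rpow (abs_nonneg _) _ hp0.le
      rw [abs_sub_comm (g []) (g [β])]
      exact abs_sub_le _ _ _
    have hVk : (0 : ℝ) < (V : ℝ) ^ k := by positivity
    calc _ ≤ _ := Finset.sum_le_sum hstep
      _ = t ^ (1 - p) * ∑ v ∈ wordsF V k, |g (β :: v) - g [β]| ^ p
          + (V : ℝ) ^ k * (C * |g [] - g [β]| ^ p) := by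
        rw [Finset.sum_add_distrib, Finset.mul_sum, Finset.sum_const, card_wordsF, nsmul_eq_mul]
        push_cast; rfl
      _ ≤ (V : ℝ) * (C * (V : ℝ) ^ k * treeE V p k (fun w => g (β :: w)))
          + (V : ℝ) ^ (k + 1) * (C * |g [] - g [β]| ^ p) := by
        gcongr
        · linarith
        · omega
      _ = _ := by rw [pow_succ]; ring

lemma rpow_abs_add_le {p : ℝ} (hp : 1 ≤ p) (a b : ℝ) :
    |a + b| ^ p ≤ 2 ^ p * (|a| ^ p + |b| ^ p) := by
  have h := rpow_add_split hp (t := 1 / 2) (by norm_num) (by norm_num) (abs_nonneg a) (abs_nonneg b)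
  have e : (1 - 1 / 2 : ℝ) = 1 / 2 := by norm_num
  rw [e] at h
  have h2 : (1 / 2 : ℝ) ^ (1 - p) ≤ 2 ^ p := by
    rw [one_div, Real.inv_rpow (by norm_num), ← Real.rpow_neg (by norm_num)]
    apply Real.rpow_le_rpow_of_exponent_le (by norm_num); linarith
  calc |a + b| ^ p ≤ (|a| + |b|) ^ p :=
        Real.rpow_le_rpow (abs_nonneg _) (abs_add_le _ _) (by linarith)
    _ ≤ _ := h
    _ ≤ 2 ^ p * |a| ^ p + 2 ^ p * |b| ^ p := by gcongr
    _ = _ := by ring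

lemma path_poincare {p : ℝ} (hp : 1 ≤ p) (m : ℕ) (X : ℕ → ℝ) (s t : ℕ) (hs : s < m) (ht : t < m) :
    |X s - X t| ^ p ≤ (m : ℝ) ^ (p - 1) * ∑ u ∈ range (m - 1), |X u - X (u + 1)| ^ p := by
  wlog hst : s ≤ t generalizing s t
  · rw [abs_sub_comm]; exact this t s ht hs (by omega)
  have h1 : |X s - X t| ≤ ∑ u ∈ Finset.Ico s t, |X u - X (u + 1)| := by
    have := Finset.sum_Ico_sub X hst
    rw [abs_sub_comm, ← this]
    refine (Finset.abs_sum_le_sum_abs _ _).trans (le_of_eq ?_)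
    exact Finset.sum_congr rfl fun u _ => abs_sub_comm _ _
  have hm : (0 : ℝ) < m := by exact_mod_cast (by omega : 0 < m)
  calc |X s - X t| ^ p ≤ (∑ u ∈ Finset.Ico s t, |X u - X (u + 1)|) ^ p :=
        Real.rpow_le_rpow (abs_nonneg _) h1 (by linarith)
    _ ≤ ((Finset.Ico s t).card : ℝ) ^ (p - 1) * ∑ u ∈ Finset.Ico s t, |X u - X (u + 1)| ^ p :=
        Real.rpow_sum_le_const_mul_sum_rpow _ _ hp
    _ ≤ _ := by
        gcongr
        · simp; omega
        · intro u hu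
          simp at hu ⊢; omega

lemma rpow_abs_add4_le {p : ℝ} (hp : 1 ≤ p) (a b c d : ℝ) :
    |a + b + (c + d)| ^ p ≤ 2 ^ p * 2 ^ p * (|a| ^ p + |b| ^ p + |c| ^ p + |d| ^ p) := by
  have h1 := rpow_abs_add_le hp (a + b) (c + d)
  have h2 := rpow_abs_add_le hp a b
  have h3 := rpow_abs_add_le hp c d
  have h0 : (0 : ℝ) < 2 ^ p := by positivity
  calc _ ≤ _ := h1
    _ ≤ 2 ^ p * (2 ^ p * (|a| ^ p + |b| ^ p) + 2 ^ p * (|c| ^ p + |d| ^ p)) := by gcongr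
    _ = _ := by ring

lemma geomV_le (V : ℕ) (hV : 2 ≤ V) (k : ℕ) :
    ∑ j ∈ range (k + 1), (V : ℝ) ^ j ≤ 2 * (V : ℝ) ^ k := by
  have hV' : (2 : ℝ) ≤ V := by exact_mod_cast hV
  induction k with
  | zero => simp
  | succ k ih =>
    rw [Finset.sum_range_succ]
    have : 0 < (V : ℝ) ^ k := by positivity
    have : 2 * (V : ℝ) ^ k ≤ (V : ℝ) ^ (k + 1) := by rw [pow_succ]; nlinarith
    linarith

set_option maxHeartbeats 1000000 in
lemma core_poincare (V : ℕ) (hV : 2 ≤ V) (p : ℝ) (hp : 1 ≤ p) :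
    ∃ K : ℝ, 0 < K ∧ ∀ (k M m : ℕ), 0 < M → M ≤ m →
      ∀ (X : List (Fin V) → ℕ → ℝ) (Z : Fin M → List (Fin V) → ℝ),
      (∀ i, ∀ v ∈ wordsF V k, ∃ t < m, Z i v = X v t) →
      ∃ c : ℝ, ∑ v ∈ wordsF V k, ∑ t ∈ range m, |X v t - c| ^ p +
          ∑ i, ∑ j ∈ range (k + 1), ∑ u ∈ wordsF V j, |Z i u - c| ^ p ≤
        K * ((m : ℝ) ^ p + (m / M : ℝ) * (V : ℝ) ^ k) *
          (∑ v ∈ wordsF V k, ∑ t ∈ range (m - 1), |X v t - X v (t + 1)| ^ p +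
            ∑ i, treeE V p k (Z i)) := by
  obtain ⟨C, hC1, hC⟩ := tree_poincare V hV p hp
  set D : ℝ := 2 ^ p * 2 ^ p with hD
  have hD0 : 0 < D := by positivity
  have hp0 : 0 < p := by linarith
  refine ⟨6 * D * C, by positivity, ?_⟩
  intro k M m hM hMm X Z hXZ
  have hM' : (0 : ℝ) < M := by exact_mod_cast hM
  have hm' : (0 : ℝ) < m := by exact_mod_cast (by omega : 0 < m)
  have hMm' : (M : ℝ) ≤ m := by exact_mod_cast hMm
  have hVk : (0 : ℝ) < (V : ℝ) ^ k := by
    have : (0 : ℝ) < V := by exact_mod_cast (by omega : 0 < V)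
    positivity
  set R : ℝ := (m / M : ℝ) with hR
  have hR1 : 1 ≤ R := by rw [hR, le_div_iff₀ hM']; linarith
  have hRM : R * M = m := by rw [hR]; field_simp
  set q : ℝ := (m : ℝ) ^ (p - 1) with hq
  have hq0 : 0 < q := by positivity
  have hmq : (m : ℝ) ^ p = m * q := by
    rw [hq, Real.rpow_sub hm', Real.rpow_one]; field_simp
  set E : List (Fin V) → ℝ := fun v => ∑ t ∈ range (m - 1), |X v t - X v (t + 1)| ^ p with hE
  have hE0 : ∀ v, 0 ≤ E v := fun v => by rw [hE]; positivity
  set A : List (Fin V) → ℝ := fun v => ∑ i, |Z i v - Z i []| ^ p with hA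
  have hA0 : ∀ v, 0 ≤ A v := fun v => by rw [hA]; positivity
  set EX : ℝ := ∑ v ∈ wordsF V k, E v with hEX
  set EZ : ℝ := ∑ i, treeE V p k (Z i) with hEZ
  have hEX0 : 0 ≤ EX := Finset.sum_nonneg fun v _ => hE0 v
  have hEZ0 : 0 ≤ EZ := Finset.sum_nonneg fun v _ => treeE_nonneg _ _ _ _
  set B : ℝ := C * ((m : ℝ) ^ p + R * (V : ℝ) ^ k) * (EX + EZ) with hB
  set b : List (Fin V) → ℝ := fun v => (m : ℝ) ^ p * E v + R * A v with hb
  have hAsum : ∑ v ∈ wordsF V k, A v ≤ C * (V : ℝ) ^ k * EZ := by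
    rw [hA, Finset.sum_comm, hEZ, Finset.mul_sum]
    exact Finset.sum_le_sum fun i _ => hC k (Z i)
  have hmp : 0 < (m : ℝ) ^ p := by positivity
  have hCB : R * (V : ℝ) ^ k * C * EZ ≤ B := by
    have h1 : 0 ≤ C * (m : ℝ) ^ p * (EX + EZ) := by positivity
    have h2 : 0 ≤ C * (R * (V : ℝ) ^ k) * EX := by positivity
    rw [hB]; nlinarith
  have hbsum : ∑ v ∈ wordsF V k, b v ≤ B := by
    rw [hb, Finset.sum_add_distrib, ← Finset.mul_sum, ← Finset.mul_sum, ← hEX]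
    have h1 : R * ∑ v ∈ wordsF V k, A v ≤ R * (C * (V : ℝ) ^ k * EZ) := by gcongr
    have h2 : (m : ℝ) ^ p * EX ≤ C * ((m : ℝ) ^ p * EX) :=
      le_mul_of_one_le_left (by positivity) hC1
    have h3 : 0 ≤ C * (m : ℝ) ^ p * EZ := by positivity
    have h4 : 0 ≤ C * (R * (V : ℝ) ^ k) * EX := by positivity
    rw [hB]; nlinarith
  have hcard : ((wordsF V k).card : ℝ) = (V : ℝ) ^ k := by rw [card_wordsF]; push_cast; rfl
  obtain ⟨v', hv', hbv'⟩ : ∃ v ∈ wordsF V k, b v ≤ B / (V : ℝ) ^ k := by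
    apply Finset.exists_le_of_sum_le
    · rw [← Finset.card_pos, card_wordsF]; exact pow_pos (by omega) _
    · rw [Finset.sum_const, nsmul_eq_mul, hcard, mul_div_cancel₀ _ hVk.ne']; exact hbsum
  rw [le_div_iff₀ hVk] at hbv'
  have hXX : ∀ v, ∀ s < m, ∀ t < m, |X v s - X v t| ^ p ≤ q * E v := fun v s hs t ht =>
    path_poincare hp m (X v) s t hs ht
  refine ⟨X v' 0, ?_⟩
  set c := X v' 0 with hc
  have hZc : ∀ i, |Z i v' - c| ^ p ≤ q * E v' := by
    intro i
    obtain ⟨t, ht, e⟩ := hXZ i v' hv'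
    rw [e]; exact hXX v' t ht 0 (by omega)
  have hline : ∀ v ∈ wordsF V k, ∑ t ∈ range m, |X v t - c| ^ p ≤ D * (b v + b v') := by
    intro v hv
    have hpt : ∀ t ∈ range m, |X v t - c| ^ p ≤ D * (b v + b v') / m := by
      intro t ht
      rw [Finset.mem_range] at ht
      have hi : ∀ i : Fin M, |X v t - c| ^ p ≤
          D * (q * E v + |Z i v - Z i []| ^ p + |Z i v' - Z i []| ^ p + q * E v') := by
        intro i
        obtain ⟨t', ht', e⟩ := hXZ i v hv
        have h1 : |X v t - Z i v| ^ p ≤ q * E v := by rw [e]; exact hXX v t ht t' ht'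
        have h4 := rpow_abs_add4_le hp (X v t - Z i v) (Z i v - Z i []) (Z i [] - Z i v')
          (Z i v' - c)
        rw [abs_sub_comm (Z i []) (Z i v')] at h4
        have e2 : X v t - Z i v + (Z i v - Z i []) + (Z i [] - Z i v' + (Z i v' - c))
          = X v t - c := by ring
        rw [e2] at h4
        refine h4.trans ?_
        have := hZc i
        gcongr
      have hs := Finset.sum_le_sum fun i (_ : i ∈ (univ : Finset (Fin M))) => hi i
      rw [Finset.sum_const, ← Finset.mul_sum, Finset.sum_add_distrib, Finset.sum_add_distrib,
        Finset.sum_add_distrib, Finset.sum_const, Finset.sum_const, Finset.card_univ,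
        Fintype.card_fin, nsmul_eq_mul, nsmul_eq_mul, nsmul_eq_mul] at hs
      rw [le_div_iff₀ hm']
      have hs2 := mul_le_mul_of_nonneg_left hs (by linarith : 0 ≤ R)
      calc |X v t - c| ^ p * m = R * (M * |X v t - c| ^ p) := by rw [← hRM]; ring
        _ ≤ _ := hs2
        _ = D * ((R * M) * q * E v + R * A v + R * A v' + (R * M) * q * E v') := by
          simp only [hA]; ring
        _ = _ := by rw [hRM]; simp only [hb]; rw [hmq]; ring
    refine (Finset.sum_le_sum hpt).trans (le_of_eq ?_)
    rw [Finset.sum_const, Finset.card_range, nsmul_eq_mul]; field_simp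
  have hlines : ∑ v ∈ wordsF V k, ∑ t ∈ range m, |X v t - c| ^ p ≤ 2 * D * B := by
    refine (Finset.sum_le_sum hline).trans ?_
    rw [← Finset.mul_sum, Finset.sum_add_distrib, Finset.sum_const, nsmul_eq_mul, hcard]
    nlinarith
  have htree : ∀ i, ∑ j ∈ range (k + 1), ∑ u ∈ wordsF V j, |Z i u - c| ^ p ≤
      2 * D * (V : ℝ) ^ k * (C * treeE V p k (Z i) + |Z i v' - Z i []| ^ p + q * E v') := by
    intro i
    set Y : ℝ := C * treeE V p k (Z i) + |Z i v' - Z i []| ^ p + q * E v' with hY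
    have hY0 : 0 ≤ Y := by
      have := treeE_nonneg V p k (Z i)
      have := hE0 v'
      positivity
    have hj : ∀ j ∈ range (k + 1), ∑ u ∈ wordsF V j, |Z i u - c| ^ p ≤ D * Y * (V : ℝ) ^ j := by
      intro j hj
      have hu : ∀ u ∈ wordsF V j, |Z i u - c| ^ p ≤
          D * (|Z i u - Z i []| ^ p + (|Z i v' - Z i []| ^ p + q * E v')) := by
        intro u _
        have h4 := rpow_abs_add4_le hp (Z i u - Z i []) (Z i [] - Z i v')
          (Z i v' - c) 0
        rw [abs_sub_comm (Z i []) (Z i v')] at h4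
        have e2 : Z i u - Z i [] + (Z i [] - Z i v') + (Z i v' - c + 0) = Z i u - c := by ring
        rw [e2, abs_zero, Real.zero_rpow hp0.ne', add_zero, add_assoc] at h4
        refine h4.trans ?_
        have := hZc i
        gcongr
      refine (Finset.sum_le_sum hu).trans ?_
      rw [← Finset.mul_sum, Finset.sum_add_distrib, Finset.sum_const, nsmul_eq_mul, card_wordsF]
      push_cast
      have h1 := hC j (Z i)
      have h2 := treeE_mono V p (by simp at hj; omega : j ≤ k) (Z i)
      have h3 : C * (V : ℝ) ^ j * treeE V p j (Z i) ≤ C * (V : ℝ) ^ j * treeE V p k (Z i) := by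
        gcongr
      calc _ ≤ D * (C * (V : ℝ) ^ j * treeE V p k (Z i) +
            (V : ℝ) ^ j * (|Z i v' - Z i []| ^ p + q * E v')) := by
            gcongr; linarith
        _ = _ := by rw [hY]; ring
    refine (Finset.sum_le_sum hj).trans ?_
    rw [← Finset.mul_sum]
    have := geomV_le V hV k
    calc _ ≤ D * Y * (2 * (V : ℝ) ^ k) := by gcongr
      _ = _ := by ring
  have htrees : ∑ i, ∑ j ∈ range (k + 1), ∑ u ∈ wordsF V j, |Z i u - c| ^ p ≤ 4 * D * B := by
    refine (Finset.sum_le_sum fun i _ => htree i).trans ?_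
    rw [← Finset.mul_sum, Finset.sum_add_distrib, Finset.sum_add_distrib, ← Finset.mul_sum,
      Finset.sum_const, Finset.card_univ, Fintype.card_fin, nsmul_eq_mul, ← hEZ]
    have h1 : A v' + M * (q * E v') ≤ b v' := by
      simp only [hb]; rw [hmq]
      have h4 : A v' ≤ R * A v' := le_mul_of_one_le_left (hA0 v') hR1
      have h5 : M * (q * E v') ≤ m * (q * E v') :=
        mul_le_mul_of_nonneg_right hMm' (mul_nonneg hq0.le (hE0 v'))
      linarith
    have h2 : (V : ℝ) ^ k * (C * EZ) ≤ B := by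
      refine le_trans ?_ hCB
      have h5 : 0 ≤ (V : ℝ) ^ k * (C * EZ) := by positivity
      have h6 := le_mul_of_one_le_left h5 hR1
      linarith
    have h3 : (V : ℝ) ^ k * (A v' + M * (q * E v')) ≤ B := by
      refine le_trans ?_ hbv'
      rw [mul_comm]; gcongr
    calc _ = 2 * D * ((V : ℝ) ^ k * (C * EZ) + (V : ℝ) ^ k * (A v' + M * (q * E v'))) := by
          simp only [hA]; ring
      _ ≤ 2 * D * (B + B) := by gcongr
      _ = _ := by ring
  calc _ ≤ 2 * D * B + 4 * D * B := add_le_add hlines htrees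
    _ = _ := by rw [hB]; ring

/-- Words of length less than `k`. -/
def wordsLt (V k : ℕ) : Finset (List (Fin V)) := (range k).biUnion (wordsF V)

lemma mem_wordsLt {V : ℕ} (k : ℕ) (w : List (Fin V)) : w ∈ wordsLt V k ↔ w.length < k := by
  simp [wordsLt, mem_wordsF]

lemma sum_wordsLt {V : ℕ} (k : ℕ) (φ : List (Fin V) → ℝ) :
    ∑ w ∈ wordsLt V k, φ w = ∑ j ∈ range k, ∑ w ∈ wordsF V j, φ w := by
  rw [wordsLt, Finset.sum_biUnion]
  intro a _ b _ hab
  rw [Function.onFun, Finset.disjoint_left]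
  intro w hw hw'
  rw [mem_wordsF] at hw hw'
  exact hab (hw.symm.trans hw')

lemma gradLpNorm_rpow {W : Type*} [Fintype W] (G : SimpleGraph W) {p : ℝ} (hp : 0 < p)
    (f : W → ℝ) {ι : Type*} (T : Finset ι) (a b : ι → W) (hadj : ∀ i ∈ T, G.Adj (a i) (b i))
    (hinj : Set.InjOn (fun i => s(a i, b i)) (T : Set ι)) :
    ∑ i ∈ T, |f (a i) - f (b i)| ^ p ≤ (gradLpNorm G p f) ^ p := by
  classical
  unfold gradLpNorm
  have hnn : ∀ e : Sym2 W, 0 ≤ Sym2.lift ⟨fun x y => |f x - f y| ^ p,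
      fun x y => by show |f x - f y| ^ p = |f y - f x| ^ p; rw [abs_sub_comm]⟩ e := by
    intro e
    induction e using Sym2.ind with
    | _ x y => simp only [Sym2.lift_mk]; positivity
  rw [← Real.rpow_mul (Finset.sum_nonneg fun e _ => hnn e), one_div, inv_mul_cancel₀ hp.ne',
    Real.rpow_one]
  have h1 : ∑ i ∈ T, |f (a i) - f (b i)| ^ p =
      ∑ e ∈ T.image (fun i => s(a i, b i)), Sym2.lift ⟨fun x y => |f x - f y| ^ p,
      fun x y => by show |f x - f y| ^ p = |f y - f x| ^ p; rw [abs_sub_comm]⟩ e := by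
    rw [Finset.sum_image hinj]
    rfl
  rw [h1]
  refine Finset.sum_le_sum_of_subset_of_nonneg ?_ fun e _ _ => hnn e
  intro e he
  rw [Finset.mem_image] at he
  obtain ⟨i, hi, rfl⟩ := he
  rw [SimpleGraph.mem_edgeFinset]
  exact hadj i hi

lemma gradLpNorm_nonneg {W : Type*} [Fintype W] (G : SimpleGraph W) (p : ℝ)
    (f : W → ℝ) : 0 ≤ gradLpNorm G p f := by
  unfold gradLpNorm
  apply Real.rpow_nonneg
  refine Finset.sum_nonneg fun e _ => ?_
  induction e using Sym2.ind with
  | _ x y => simp only [Sym2.lift_mk]; positivity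

lemma exists_mean_zero {W : Type*} [Fintype W] [Nontrivial W] :
    ∃ f : W → ℝ, ∑ v, f v = 0 ∧ f ≠ 0 ∧ (∀ v, |f v| ≤ 1) ∧ ∃ v, f v = 1 := by
  classical
  obtain ⟨x, y, hxy⟩ := exists_pair_ne W
  refine ⟨fun w => (if w = x then 1 else 0) - (if w = y then 1 else 0), ?_, ?_, ?_, x, ?_⟩
  · simp [Finset.sum_sub_distrib]
  · intro h
    have := congrFun h x
    simp [hxy] at this
  · intro v
    dsimp only
    split_ifs <;> simp
  · simp [hxy]

lemma poincareConst_ge {W : Type*} [Fintype W] [Nontrivial W] (G : SimpleGraph W) {p : ℝ}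
    (hp : 0 < p) {K : ℝ} (hK : 0 < K)
    (h : ∀ f : W → ℝ, ∑ v, f v = 0 → ∑ v, |f v| ^ p ≤ K * (gradLpNorm G p f) ^ p) :
    K ^ (-(1 / p)) ≤ poincareConst G p := by
  unfold poincareConst
  apply le_csInf
  · obtain ⟨f, h1, h2, -⟩ := exists_mean_zero (W := W)
    exact ⟨_, f, h1, h2, rfl⟩
  · rintro c ⟨f, h1, h2, rfl⟩
    have hg := gradLpNorm_nonneg G p f
    have hpos : 0 < ∑ v, |f v| ^ p := by
      obtain ⟨v, hv⟩ := Function.ne_iff.1 h2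
      refine Finset.sum_pos' (fun _ _ => by positivity) ⟨v, Finset.mem_univ _, ?_⟩
      exact Real.rpow_pos_of_pos (abs_pos.2 hv) _
    have hl : 0 < lpNorm p f := Real.rpow_pos_of_pos hpos _
    rw [le_div_iff₀ hl]
    have h3 : lpNorm p f ≤ (K * (gradLpNorm G p f) ^ p) ^ (1 / p) :=
      Real.rpow_le_rpow hpos.le (h f h1) (by positivity)
    rw [Real.mul_rpow hK.le (by positivity), ← Real.rpow_mul hg, mul_one_div_cancel hp.ne',
      Real.rpow_one] at h3
    calc K ^ (-(1 / p)) * lpNorm p f ≤ K ^ (-(1 / p)) * (K ^ (1 / p) * gradLpNorm G p f) := by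
          gcongr
      _ = gradLpNorm G p f := by
          rw [← mul_assoc, ← Real.rpow_add hK]; simp

lemma profile_bdd {W : Type*} (X : SimpleGraph W) {p : ℝ} (hp : 1 ≤ p) (r : ℝ) :
    BddAbove { c : ℝ | ∃ (s : Finset W) (G : SimpleGraph s),
    (∀ u v : s, G.Adj u v → X.Adj u v) ∧ (s.card : ℝ) ≤ r ∧
    c = (s.card : ℝ) * poincareConst G p } := by
  classical
  have hp0 : 0 < p := by linarith
  refine ⟨|r| * ((|r| * |r|) * 2 ^ p) ^ (1 / p), ?_⟩
  rintro c ⟨s, G, -, hs, rfl⟩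
  have hs' : (s.card : ℝ) ≤ |r| := hs.trans (le_abs_self r)
  have key : poincareConst G p ≤ ((|r| * |r|) * 2 ^ p) ^ (1 / p) := by
    by_cases hnt : Nontrivial s
    · obtain ⟨f, h1, h2, h3, v, h4⟩ := exists_mean_zero (W := s)
      have hbb : BddBelow { c : ℝ | ∃ f : s → ℝ, (∑ v, f v) = 0 ∧ f ≠ 0 ∧
          c = gradLpNorm G p f / lpNorm p f } := by
        refine ⟨0, ?_⟩
        rintro c ⟨f, -, -, rfl⟩
        apply div_nonneg (gradLpNorm_nonneg _ _ _)
        unfold lpNorm; positivity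
      have hle : poincareConst G p ≤ gradLpNorm G p f / lpNorm p f :=
        csInf_le hbb ⟨f, h1, h2, rfl⟩
      refine hle.trans ?_
      have hl : 1 ≤ lpNorm p f := by
        unfold lpNorm
        apply Real.one_le_rpow _ (by positivity)
        have := Finset.single_le_sum (f := fun v => |f v| ^ p)
          (fun i _ => by positivity) (Finset.mem_univ v)
        simpa [h4] using this
      refine (div_le_self (gradLpNorm_nonneg _ _ _) hl).trans ?_
      unfold gradLpNorm
      apply Real.rpow_le_rpow _ _ (by positivity)
      · refine Finset.sum_nonneg fun e _ => ?_
        induction e using Sym2.ind with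
        | _ x y => simp only [Sym2.lift_mk]; positivity
      · refine (Finset.sum_le_card_nsmul _ _ ((2 : ℝ) ^ p) ?_).trans ?_
        · intro e _
          induction e using Sym2.ind with
          | _ x y =>
            simp only [Sym2.lift_mk]
            apply Real.rpow_le_rpow (abs_nonneg _) _ hp0.le
            have := abs_sub (f x) (f y)
            have := h3 x
            have := h3 y
            linarith
        · rw [nsmul_eq_mul]
          gcongr
          let _ := Classical.decRel G.Adj
          have h5 := G.card_edgeFinset_le_card_choose_two
          rw [Fintype.card_coe] at h5
          have h6 : s.card.choose 2 ≤ s.card * s.card := by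
            rw [Nat.choose_two_right]
            exact (Nat.div_le_self _ _).trans (Nat.mul_le_mul_left _ (Nat.sub_le _ _))
          have h7 : (G.edgeFinset.card : ℝ) ≤ (s.card : ℝ) * s.card := by
            exact_mod_cast h5.trans h6
          refine le_trans (le_of_eq ?_) (h7.trans (by gcongr))
          congr!
    · have : poincareConst G p = 0 := by
        unfold poincareConst
        convert Real.sInf_empty
        rw [Set.eq_empty_iff_forall_notMem]
        rintro c ⟨f, h1, h2, -⟩
        apply h2
        rw [not_nontrivial_iff_subsingleton] at hnt
        funext v
        have : ∑ w, f w = f v := by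
          refine Finset.sum_eq_single v (fun w _ hw => absurd (Subsingleton.elim w v) hw) (by simp)
        rw [this] at h1
        exact h1
      rw [this]; positivity
  calc (s.card : ℝ) * poincareConst G p ≤ (s.card : ℝ) * ((|r| * |r|) * 2 ^ p) ^ (1 / p) := by
        gcongr
    _ ≤ _ := by gcongr

lemma mean_zero_le {W : Type*} [Fintype W] {p : ℝ} (hp : 1 ≤ p) (f : W → ℝ)
    (hf : ∑ v, f v = 0) (c : ℝ) :
    ∑ v, |f v| ^ p ≤ 2 ^ p * 2 * ∑ v, |f v - c| ^ p := by
  have hp0 : 0 < p := by linarith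
  have h1 : (Fintype.card W : ℝ) * |c| ^ p ≤ ∑ v, |f v - c| ^ p := by
    rcases Nat.eq_zero_or_pos (Fintype.card W) with h0 | h0
    · rw [h0]; simp only [Nat.cast_zero, zero_mul]; positivity
    have hN : (0 : ℝ) < Fintype.card W := by exact_mod_cast h0
    have h2 := Real.rpow_sum_le_const_mul_sum_rpow (univ : Finset W) (fun v => f v - c) hp
    have h3 : (Fintype.card W : ℝ) * |c| ≤ ∑ v, |f v - c| := by
      have := Finset.abs_sum_le_sum_abs (fun v => f v - c) univ
      rw [Finset.sum_sub_distrib, hf, Finset.sum_const, nsmul_eq_mul, Finset.card_univ, zero_sub,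
        abs_neg, abs_mul, abs_of_pos hN] at this
      exact this
    have h4 := (Real.rpow_le_rpow (by positivity) h3 hp0.le).trans h2
    rw [Finset.card_univ, Real.mul_rpow hN.le (abs_nonneg _)] at h4
    have h5 : (Fintype.card W : ℝ) ^ p =
        (Fintype.card W : ℝ) ^ (p - 1) * (Fintype.card W : ℝ) := by
      rw [Real.rpow_sub hN, Real.rpow_one]; field_simp
    rw [h5, mul_assoc] at h4
    exact le_of_mul_le_mul_left h4 (by positivity)
  have h2 : ∀ v ∈ (univ : Finset W), |f v| ^ p ≤ 2 ^ p * (|f v - c| ^ p + |c| ^ p) := by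
    intro v _
    have := rpow_abs_add_le hp (f v - c) c
    rwa [sub_add_cancel] at this
  refine (Finset.sum_le_sum h2).trans ?_
  rw [← Finset.mul_sum, Finset.sum_add_distrib, Finset.sum_const, nsmul_eq_mul, Finset.card_univ,
    mul_assoc]
  gcongr
  linarith

/-- The vertex set made of the lines `x v` and the trees `z i`. -/
def skel {α : Type*} [DecidableEq α] (V k M m : ℕ) (x : List (Fin V) → ℕ → α)
    (z : Fin M → List (Fin V) → α) : Finset α :=
  (wordsF V k ×ˢ range m).image (fun a => x a.1 a.2) ∪
    ((univ : Finset (Fin M)) ×ˢ wordsLt V (k + 1)).image (fun a => z a.1 a.2)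

lemma skel_card_ge {α : Type*} [DecidableEq α] (V k M m : ℕ) (x : List (Fin V) → ℕ → α)
    (z : Fin M → List (Fin V) → α)
    (hx : ∀ v ∈ wordsF V k, ∀ t < m, ∀ v' ∈ wordsF V k, ∀ t' < m, x v t = x v' t' →
      v = v' ∧ t = t') : V ^ k * m ≤ (skel V k M m x z).card := by
  refine le_trans (le_of_eq ?_) (Finset.card_le_card Finset.subset_union_left)
  rw [Finset.card_image_of_injOn, Finset.card_product, card_wordsF, Finset.card_range]
  rintro ⟨v, t⟩ h ⟨v', t'⟩ h' e
  simp only [Finset.coe_product, Set.mem_prod, Finset.mem_coe, Finset.mem_range] at h h'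
  obtain ⟨rfl, rfl⟩ := hx v h.1 t h.2 v' h'.1 t' h'.2 e
  rfl

lemma skel_card_le {α : Type*} [DecidableEq α] (V k M m : ℕ) (hV : 2 ≤ V)
    (x : List (Fin V) → ℕ → α)
    (z : Fin M → List (Fin V) → α) :
    ((skel V k M m x z).card : ℝ) ≤ (V : ℝ) ^ k * m + M * (2 * (V : ℝ) ^ k) := by
  have h1 : (skel V k M m x z).card ≤ V ^ k * m + M * (wordsLt V (k + 1)).card := by
    refine (Finset.card_union_le _ _).trans (add_le_add ?_ ?_)
    · refine Finset.card_image_le.trans (le_of_eq ?_)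
      rw [Finset.card_product, card_wordsF, Finset.card_range]
    · refine Finset.card_image_le.trans (le_of_eq ?_)
      rw [Finset.card_product, Finset.card_univ, Fintype.card_fin]
  have h2 : ((wordsLt V (k + 1)).card : ℝ) ≤ 2 * (V : ℝ) ^ k := by
    have := sum_wordsLt (V := V) (k + 1) (fun _ => 1)
    simp only [Finset.sum_const, nsmul_eq_mul, mul_one, card_wordsF] at this
    push_cast at this
    rw [this]
    exact geomV_le V hV k
  have h3 : ((skel V k M m x z).card : ℝ) ≤ (V : ℝ) ^ k * m + M * (wordsLt V (k + 1)).card := by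
    exact_mod_cast h1
  refine h3.trans ?_
  gcongr

lemma skel_poincare (V : ℕ) (hV : 2 ≤ V) (p : ℝ) (hp : 1 ≤ p) :
    ∃ K : ℝ, 0 < K ∧ ∀ {α : Type} [DecidableEq α] (Γ : SimpleGraph α) (k M m : ℕ),
      0 < M → M ≤ m →
      ∀ (x : List (Fin V) → ℕ → α) (z : Fin M → List (Fin V) → α),
      (∀ i, ∀ v ∈ wordsF V k, ∃ t < m, z i v = x v t) →
      (∀ v ∈ wordsF V k, ∀ t < m, ∀ v' ∈ wordsF V k, ∀ t' < m, x v t = x v' t' →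
        v = v' ∧ t = t') →
      (∀ i i' u u', z i u = z i' u' → i = i' ∧ u = u') →
      (∀ v ∈ wordsF V k, ∀ t, t + 1 < m → Γ.Adj (x v t) (x v (t + 1))) →
      (∀ i u β, Γ.Adj (z i u) (z i (u ++ [β]))) →
      Nontrivial (skel V k M m x z) →
      (K * ((m : ℝ) ^ p + (m / M : ℝ) * (V : ℝ) ^ k)) ^ (-(1 / p)) ≤
        poincareConst (Γ.comap (Subtype.val : skel V k M m x z → α)) p := by
  obtain ⟨K, hK, hcore⟩ := core_poincare V hV p hp
  have hp0 : 0 < p := by linarith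
  have h2p : (0 : ℝ) < 2 ^ p := by positivity
  refine ⟨2 ^ p * 2 * K * 2, by positivity, ?_⟩
  intro α _ Γ k M m hM hMm x z hzx hx hz hxadj hzadj hnt
  have hM' : (0 : ℝ) < M := by exact_mod_cast hM
  have hm' : (0 : ℝ) < m := by exact_mod_cast (by omega : 0 < m)
  have hVk : (0 : ℝ) < (V : ℝ) ^ k := by
    have : (0 : ℝ) < V := by exact_mod_cast (by omega : 0 < V)
    positivity
  set s := skel V k M m x z with hs
  set G := Γ.comap (Subtype.val : s → α) with hG
  apply poincareConst_ge G hp0 (by positivity)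
  intro f hf
  set F : α → ℝ := fun w => if h : w ∈ s then f ⟨w, h⟩ else 0 with hF
  have hFs : ∀ w (h : w ∈ s), F w = f ⟨w, h⟩ := fun w h => by simp [hF, h]
  have hxs : ∀ v ∈ wordsF V k, ∀ t < m, x v t ∈ s := by
    intro v hv t ht
    refine Finset.mem_union_left _ (Finset.mem_image.2 ⟨(v, t), ?_, rfl⟩)
    simp [hv, ht]
  have hzs : ∀ i, ∀ u ∈ wordsLt V (k + 1), z i u ∈ s := by
    intro i u hu
    refine Finset.mem_union_right _ (Finset.mem_image.2 ⟨(i, u), ?_, rfl⟩)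
    simp [hu]
  obtain ⟨c, hc⟩ := hcore k M m hM hMm (fun v t => F (x v t)) (fun i u => F (z i u)) (by
    intro i v hv
    obtain ⟨t, ht, e⟩ := hzx i v hv
    exact ⟨t, ht, by simp only [e]⟩)
  set E := (gradLpNorm G p f) ^ p with hE
  have hEX : ∑ v ∈ wordsF V k, ∑ t ∈ range (m - 1), |F (x v t) - F (x v (t + 1))| ^ p ≤ E := by
    obtain ⟨w0⟩ : Nonempty s := inferInstance
    have h1 := gradLpNorm_rpow G hp0 f (wordsF V k ×ˢ range (m - 1))
      (fun a => if h : x a.1 a.2 ∈ s then ⟨_, h⟩ else w0)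
      (fun a => if h : x a.1 (a.2 + 1) ∈ s then ⟨_, h⟩ else w0) ?_ ?_
    · refine le_trans (le_of_eq ?_) h1
      rw [Finset.sum_product]
      refine Finset.sum_congr rfl fun v hv => Finset.sum_congr rfl fun t ht => ?_
      rw [Finset.mem_range] at ht
      have ha := hxs v hv t (by omega)
      have hb := hxs v hv (t + 1) (by omega)
      simp only [ha, hb, dif_pos, hFs]
    · rintro ⟨v, t⟩ h
      simp only [Finset.mem_product, Finset.mem_range] at h
      have ha := hxs v h.1 t (by omega)
      have hb := hxs v h.1 (t + 1) (by omega)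
      simp only [ha, hb, dif_pos, hG, SimpleGraph.comap_adj]
      exact hxadj v h.1 t (by omega)
    · rintro ⟨v, t⟩ h ⟨v', t'⟩ h' e
      simp only [Finset.coe_product, Set.mem_prod, Finset.mem_coe, Finset.mem_range] at h h'
      have ha := hxs v h.1 t (by omega)
      have hb := hxs v h.1 (t + 1) (by omega)
      have ha' := hxs v' h'.1 t' (by omega)
      have hb' := hxs v' h'.1 (t' + 1) (by omega)
      simp only [ha, hb, ha', hb', dif_pos, Sym2.eq_iff, Subtype.mk.injEq] at e
      rcases e with ⟨e, -⟩ | ⟨e, e'⟩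
      · obtain ⟨rfl, rfl⟩ := hx v h.1 t (by omega) v' h'.1 t' (by omega) e
        rfl
      · have h1 := (hx v h.1 t (by omega) v' h'.1 (t' + 1) (by omega) e).2
        have h2 := (hx v h.1 (t + 1) (by omega) v' h'.1 t' (by omega) e').2
        omega
  have hEZ : ∑ i, treeE V p k (fun u => F (z i u)) ≤ E := by
    obtain ⟨w0⟩ : Nonempty s := inferInstance
    have h1 := gradLpNorm_rpow G hp0 f
      ((univ : Finset (Fin M)) ×ˢ (wordsLt V k ×ˢ (univ : Finset (Fin V))))
      (fun a => if h : z a.1 a.2.1 ∈ s then ⟨_, h⟩ else w0)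
      (fun a => if h : z a.1 (a.2.1 ++ [a.2.2]) ∈ s then ⟨_, h⟩ else w0) ?_ ?_
    · refine le_trans (le_of_eq ?_) h1
      rw [Finset.sum_product]
      refine Finset.sum_congr rfl fun i _ => ?_
      rw [Finset.sum_product, treeE, ← sum_wordsLt]
      refine Finset.sum_congr rfl fun v hv => Finset.sum_congr rfl fun t ht => ?_
      rw [mem_wordsLt] at hv
      have ha := hzs i v (by rw [mem_wordsLt]; omega)
      have hb := hzs i (v ++ [t]) (by rw [mem_wordsLt, List.length_append]; simp; omega)
      simp only [ha, hb, dif_pos, hFs]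
    · rintro ⟨i, u, β⟩ h
      simp only [Finset.mem_product, mem_wordsLt] at h
      have ha := hzs i u (by rw [mem_wordsLt]; omega)
      have hb := hzs i (u ++ [β]) (by rw [mem_wordsLt, List.length_append]; simp; omega)
      simp only [ha, hb, dif_pos, hG, SimpleGraph.comap_adj]
      exact hzadj i u β
    · rintro ⟨i, u, β⟩ h ⟨i', u', β'⟩ h' e
      simp only [Finset.coe_product, Set.mem_prod, Finset.mem_coe, mem_wordsLt] at h h'
      have ha := hzs i u (by rw [mem_wordsLt]; omega)
      have hb := hzs i (u ++ [β]) (by rw [mem_wordsLt, List.length_append]; simp; omega)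
      have ha' := hzs i' u' (by rw [mem_wordsLt]; omega)
      have hb' := hzs i' (u' ++ [β']) (by rw [mem_wordsLt, List.length_append]; simp; omega)
      simp only [ha, hb, ha', hb', dif_pos, Sym2.eq_iff, Subtype.mk.injEq] at e
      rcases e with ⟨e, e'⟩ | ⟨e, e'⟩
      · obtain ⟨rfl, rfl⟩ := hz _ _ _ _ e
        have := (hz _ _ _ _ e').2
        simp only [List.append_cancel_left_eq, List.cons.injEq, and_true] at this
        rw [this]
      · have h1 := congrArg List.length (hz _ _ _ _ e).2
        have h2 := congrArg List.length (hz _ _ _ _ e').2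
        simp only [List.length_append, List.length_cons, List.length_nil] at h1 h2
        omega
  have hsum : ∑ w : s, |f w - c| ^ p ≤
      ∑ v ∈ wordsF V k, ∑ t ∈ range m, |F (x v t) - c| ^ p +
          ∑ i, ∑ j ∈ range (k + 1), ∑ u ∈ wordsF V j, |F (z i u) - c| ^ p := by
    have e1 : ∑ w : s, |f w - c| ^ p = ∑ w ∈ s, |F w - c| ^ p := by
      rw [← Finset.sum_coe_sort s]
      exact Finset.sum_congr rfl fun w _ => by rw [hFs w.1 w.2]
    rw [e1, hs, skel]
    have hnn : ∀ w, 0 ≤ |F w - c| ^ p := fun w => by positivity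
    have h2 := Finset.sum_union_inter (f := fun w => |F w - c| ^ p)
      (s₁ := (wordsF V k ×ˢ range m).image (fun a => x a.1 a.2))
      (s₂ := ((univ : Finset (Fin M)) ×ˢ wordsLt V (k + 1)).image (fun a => z a.1 a.2))
    have h3 : 0 ≤ ∑ w ∈ (wordsF V k ×ˢ range m).image (fun a => x a.1 a.2) ∩
      ((univ : Finset (Fin M)) ×ˢ wordsLt V (k + 1)).image (fun a => z a.1 a.2),
        |F w - c| ^ p := Finset.sum_nonneg fun w _ => hnn w
    have h4 : ∑ w ∈ (wordsF V k ×ˢ range m).image (fun a => x a.1 a.2), |F w - c| ^ p =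
        ∑ v ∈ wordsF V k, ∑ t ∈ range m, |F (x v t) - c| ^ p := by
      rw [Finset.sum_image, Finset.sum_product]
      rintro ⟨v, t⟩ h ⟨v', t'⟩ h' e
      simp only [Finset.coe_product, Set.mem_prod, Finset.mem_coe, Finset.mem_range] at h h'
      obtain ⟨rfl, rfl⟩ := hx v h.1 t h.2 v' h'.1 t' h'.2 e
      rfl
    have h5 : ∑ w ∈ ((univ : Finset (Fin M)) ×ˢ wordsLt V (k + 1)).image (fun a => z a.1 a.2),
        |F w - c| ^ p = ∑ i, ∑ j ∈ range (k + 1), ∑ u ∈ wordsF V j, |F (z i u) - c| ^ p := by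
      rw [Finset.sum_image, Finset.sum_product]
      · exact Finset.sum_congr rfl fun i _ => sum_wordsLt _ _
      rintro ⟨i, u⟩ h ⟨i', u'⟩ h' e
      obtain ⟨rfl, rfl⟩ := hz _ _ _ _ e
      rfl
    linarith
  have hfin := mean_zero_le hp f hf c
  have h1 := hsum.trans hc
  have h2 : K * ((m : ℝ) ^ p + (m / M : ℝ) * (V : ℝ) ^ k) *
          (∑ v ∈ wordsF V k, ∑ t ∈ range (m - 1), |F (x v t) - F (x v (t + 1))| ^ p +
            ∑ i, treeE V p k (fun u => F (z i u))) ≤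
      K * ((m : ℝ) ^ p + (m / M : ℝ) * (V : ℝ) ^ k) * (E + E) := by gcongr
  calc _ ≤ _ := hfin
    _ ≤ 2 ^ p * 2 * (K * ((m : ℝ) ^ p + (m / M : ℝ) * (V : ℝ) ^ k) * (E + E)) := by
      gcongr; exact h1.trans h2
    _ = _ := by ring

lemma lexLt_iff_lt {n : ℕ} (a b : List (Fin n)) : LexLt a b ↔ a < b := Iff.rfl

lemma list_lt_append {n : ℕ} {a b : List (Fin n)} (h : a < b) (hl : a.length = b.length)
    (c d : List (Fin n)) : a ++ c < b ++ d := by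
  change List.Lex (· < ·) a b at h
  change List.Lex (· < ·) (a ++ c) (b ++ d)
  induction h with
  | nil => simp at hl
  | cons h ih => exact List.Lex.cons (ih (by simpa using hl))
  | rel h => exact List.Lex.rel h

lemma filter_le_card {β : Type*} [LinearOrder β] (L : Finset β) (t : Fin L.card) :
    (L.filter (· ≤ L.orderEmbOfFin rfl t)).card = t + 1 := by
  have : L.filter (· ≤ L.orderEmbOfFin rfl t) =
      (Finset.Iic t).map (L.orderEmbOfFin rfl).toEmbedding := by
    ext w
    simp only [Finset.mem_filter, Finset.mem_map, Finset.mem_Iic]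
    constructor
    · rintro ⟨hw, hle⟩
      have hr : w ∈ Set.range (L.orderEmbOfFin rfl) := by
        rw [Finset.range_orderEmbOfFin]; exact hw
      obtain ⟨s, rfl⟩ := hr
      exact ⟨s, (OrderEmbedding.le_iff_le _).1 hle, rfl⟩
    · rintro ⟨s, hs, rfl⟩
      exact ⟨Finset.orderEmbOfFin_mem _ _ _, (OrderEmbedding.le_iff_le _).2 hs⟩
  rw [this, Finset.card_map, Fin.card_Iic]

section
open Classical

/-- The horizontal line above the word `v`. -/
noncomputable def lineF {H V : ℕ} (S : Set (RTVert H V)) (v : List (Fin V)) :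
    Finset (List (Fin H)) :=
  (wordsF H v.length).filter fun h => (h, v) ∈ S

lemma mem_lineF {H V : ℕ} {S : Set (RTVert H V)} {Γ : SimpleGraph (RTVert H V)}
    (hΓ : IsRoundTreeGraph H V S Γ) (h : List (Fin H)) (v : List (Fin V)) :
    h ∈ lineF S v ↔ (h, v) ∈ S := by
  rw [lineF, Finset.mem_filter, mem_wordsF]
  exact ⟨fun a => a.2, fun a => ⟨hΓ.2.1 _ a, a⟩⟩

lemma mem_child {H V : ℕ} {S : Set (RTVert H V)} {Γ : SimpleGraph (RTVert H V)}
    (hΓ : IsRoundTreeGraph H V S Γ) {h : List (Fin H)} {v : List (Fin V)} (hv : (h, v) ∈ S)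
    (α : Fin H) (hα : (α : ℕ) < 2) (β : Fin V) : (h ++ [α], v ++ [β]) ∈ S := by
  obtain ⟨Δ, h2, -, h3⟩ := hΓ.2.2.2.1 h v hv β
  exact (h3 α).2 (by omega)

lemma card_lineF {H V : ℕ} (hH : 2 ≤ H) {S : Set (RTVert H V)} {Γ : SimpleGraph (RTVert H V)}
    (hΓ : IsRoundTreeGraph H V S Γ) (v : List (Fin V)) : 2 ^ v.length ≤ (lineF S v).card := by
  induction v using List.reverseRecOn with
  | nil =>
    have : ([] : List (Fin H)) ∈ lineF S ([] : List (Fin V)) := by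
      rw [mem_lineF hΓ]; exact hΓ.1
    simpa using Finset.card_pos.2 ⟨_, this⟩
  | append_singleton v β ih =>
    have hsub : (lineF S v ×ˢ (univ : Finset (Fin 2))).image
        (fun a => a.1 ++ [Fin.castLE hH a.2]) ⊆ lineF S (v ++ [β]) := by
      intro w hw
      rw [Finset.mem_image] at hw
      obtain ⟨⟨h, a⟩, hm, rfl⟩ := hw
      rw [Finset.mem_product, mem_lineF hΓ] at hm
      rw [mem_lineF hΓ]
      exact mem_child hΓ hm.1 _ (by simp; omega) β
    have hc := Finset.card_le_card hsub
    rw [Finset.card_image_of_injective, Finset.card_product, Finset.card_univ,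
      Fintype.card_fin] at hc
    · rw [List.length_append, List.length_singleton, pow_succ]
      omega
    · rintro ⟨h, a⟩ ⟨h', a'⟩ e
      simp only at e
      obtain ⟨e1, e2⟩ := List.append_inj' e rfl
      simp only [List.cons.injEq, and_true] at e2
      rw [e1, Fin.castLE_injective hH e2]

lemma take_mem {H V : ℕ} {S : Set (RTVert H V)} {Γ : SimpleGraph (RTVert H V)}
    (hΓ : IsRoundTreeGraph H V S Γ) (v u : List (Fin V)) (w : List (Fin H))
    (hw : (w, v ++ u) ∈ S) : (w.take v.length, v) ∈ S := by
  induction u using List.reverseRecOn generalizing w with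
  | nil =>
    rw [List.append_nil] at hw
    have := hΓ.2.1 _ hw
    simp only at this
    rw [← this, List.take_length]; exact hw
  | append_singleton u β ih =>
    have hl := hΓ.2.1 _ hw
    simp only [List.length_append, List.length_singleton] at hl
    rcases List.eq_nil_or_concat w with rfl | ⟨w', a, rfl⟩
    · simp at hl
    · rw [List.concat_eq_append] at hw hl ⊢
      simp only [List.length_append, List.length_singleton] at hl
      rw [← List.append_assoc] at hw
      have h1 := ih w' (hΓ.2.2.1 _ _ _ _ hw).1
      rw [List.take_append_of_le_length (by omega)]
      exact h1

lemma roundTree_skel {H V : ℕ} (hH : 2 ≤ H) (hV : 2 ≤ V) {S : Set (RTVert H V)}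
    {Γ : SimpleGraph (RTVert H V)}
    (hΓ : IsRoundTreeGraph H V S Γ) (k M : ℕ) :
    ∃ (x : List (Fin V) → ℕ → RTVert H V) (z : Fin M → List (Fin V) → RTVert H V),
      (∀ i, ∀ v ∈ wordsF V k, ∃ t < M * H ^ k, z i v = x v t) ∧
      (∀ v ∈ wordsF V k, ∀ t < M * H ^ k, ∀ v' ∈ wordsF V k, ∀ t' < M * H ^ k,
        x v t = x v' t' → v = v' ∧ t = t') ∧
      (∀ i i' u u', z i u = z i' u' → i = i' ∧ u = u') ∧
      (∀ v ∈ wordsF V k, ∀ t, t + 1 < M * H ^ k → Γ.Adj (x v t) (x v (t + 1))) ∧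
      (∀ i u β, Γ.Adj (z i u) (z i (u ++ [β]))) := by
  set m := M * H ^ k with hm
  let o : Fin H := ⟨0, by omega⟩
  obtain ⟨n, hn⟩ : ∃ n, m ≤ 2 ^ n := ⟨m, Nat.lt_two_pow_self.le⟩
  set v0 : List (Fin V) := List.replicate n ⟨0, by omega⟩ with hv0
  have hv0l : v0.length = n := by simp [hv0]
  have hcard : ∀ u : List (Fin V), m ≤ (lineF S (v0 ++ u)).card := by
    intro u
    refine le_trans (hn.trans ?_) (card_lineF hH hΓ _)
    apply Nat.pow_le_pow_right (by norm_num)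
    rw [List.length_append]; omega
  have hM0 : M ≤ (lineF S v0).card := by
    have := hcard []
    rw [List.append_nil] at this
    refine le_trans ?_ this
    exact Nat.le_mul_of_pos_right _ (pow_pos (by omega) _)
  let hh : Fin M → List (Fin H) := fun i =>
    (lineF S v0).orderEmbOfFin rfl ⟨i, lt_of_lt_of_le i.2 hM0⟩
  have hhS : ∀ i, (hh i, v0) ∈ S := fun i =>
    (mem_lineF hΓ _ _).1 (Finset.orderEmbOfFin_mem _ _ _)
  have hhl : ∀ i, (hh i).length = n := fun i => (hΓ.2.1 _ (hhS i)).trans hv0l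
  let x : List (Fin V) → ℕ → RTVert H V := fun u t =>
    if ht : t < (lineF S (v0 ++ u)).card then
      ((lineF S (v0 ++ u)).orderEmbOfFin rfl ⟨t, ht⟩, v0 ++ u) else ([], v0 ++ u)
  have hxe : ∀ u t (ht : t < m), x u t = ((lineF S (v0 ++ u)).orderEmbOfFin rfl
      ⟨t, lt_of_lt_of_le ht (hcard u)⟩, v0 ++ u) := by
    intro u t ht
    exact dif_pos (lt_of_lt_of_le ht (hcard u))
  let z : Fin M → List (Fin V) → RTVert H V := fun i u =>
    (hh i ++ List.replicate u.length o, v0 ++ u)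
  have hzsucc : ∀ i u β, z i (u ++ [β]) =
      (hh i ++ List.replicate u.length o ++ [o], v0 ++ u ++ [β]) := by
    intro i u β
    simp only [z, List.length_append, List.length_singleton, List.replicate_succ',
      List.append_assoc]
  have hzS : ∀ i u, z i u ∈ S := by
    intro i u
    induction u using List.reverseRecOn with
    | nil => simpa [z] using hhS i
    | append_singleton u β ih =>
      rw [hzsucc]
      exact mem_child hΓ ih o (by simp [o]) β
  refine ⟨x, z, ?_, ?_, ?_, ?_, ?_⟩
  · intro i v hv
    rw [mem_wordsF] at hv
    have hmem : hh i ++ List.replicate v.length o ∈ lineF S (v0 ++ v) :=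
      (mem_lineF hΓ _ _).2 (hzS i v)
    have hr : hh i ++ List.replicate v.length o ∈
        Set.range ((lineF S (v0 ++ v)).orderEmbOfFin rfl) := by
      rw [Finset.range_orderEmbOfFin]; exact hmem
    obtain ⟨t, ht⟩ := hr
    have h1 := filter_le_card (lineF S (v0 ++ v)) t
    have h2 := filter_le_card (lineF S v0) ⟨i, lt_of_lt_of_le i.2 hM0⟩
    have htm : (t : ℕ) < m := by
      have hle : ((lineF S (v0 ++ v)).filter
          (· ≤ (lineF S (v0 ++ v)).orderEmbOfFin rfl t)).card ≤
          ((lineF S v0).filter (· ≤ hh i) ×ˢ wordsF H k).card := by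
        apply Finset.card_le_card_of_injOn (fun w => (w.take n, w.drop n))
        · intro w hw
          simp only [Finset.coe_filter, Set.mem_ofPred_eq] at hw
          obtain ⟨hw, hwle⟩ := hw
          rw [mem_lineF hΓ] at hw
          have hlen := hΓ.2.1 _ hw
          simp only [List.length_append] at hlen
          have hS := take_mem hΓ v0 v w hw
          rw [hv0l] at hS hlen
          simp only [Finset.coe_product, Set.mem_prod, Finset.mem_coe, Finset.mem_filter,
            mem_lineF hΓ, mem_wordsF]
          refine ⟨⟨hS, ?_⟩, by rw [List.length_drop]; omega⟩
          by_contra hlt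
          rw [not_le] at hlt
          have h5 := list_lt_append hlt (by rw [hhl, List.length_take]; omega)
            (List.replicate v.length o) (w.drop n)
          rw [List.take_append_drop, ← ht] at h5
          exact absurd hwle (not_le.2 h5)
        · intro w _ w' _ e
          simp only [Prod.mk.injEq] at e
          rw [← List.take_append_drop n w, ← List.take_append_drop n w', e.1, e.2]
      rw [h1, Finset.card_product, card_wordsF] at hle
      have h2' : ((lineF S v0).filter (· ≤ hh i)).card = i + 1 := h2
      rw [h2'] at hle
      have h6 : ((i : ℕ) + 1) * H ^ k ≤ m := Nat.mul_le_mul_right _ i.2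
      omega
    refine ⟨t, htm, ?_⟩
    rw [hxe v t htm]
    simp only [z]
    rw [← ht]
  · intro v _ t ht v' _ t' ht' e
    rw [hxe v t ht, hxe v' t' ht', Prod.mk.injEq] at e
    have hvv : v = v' := List.append_cancel_left e.2
    subst hvv
    refine ⟨rfl, ?_⟩
    have := ((lineF S (v0 ++ v)).orderEmbOfFin rfl).injective e.1
    simpa using this
  · intro i i' u u' e
    simp only [z, Prod.mk.injEq] at e
    have hvv : u = u' := List.append_cancel_left e.2
    subst hvv
    refine ⟨?_, rfl⟩
    have e1 := List.append_cancel_right e.1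
    have := ((lineF S v0).orderEmbOfFin rfl).injective e1
    simpa [Fin.ext_iff] using this
  · intro v _ t ht
    rw [hxe v t (by omega), hxe v (t + 1) ht]
    apply hΓ.2.2.2.2.1
    · exact (mem_lineF hΓ _ _).1 (Finset.orderEmbOfFin_mem _ _ _)
    · exact (mem_lineF hΓ _ _).1 (Finset.orderEmbOfFin_mem _ _ _)
    · rw [lexLt_iff_lt, OrderEmbedding.lt_iff_lt]
      simp
    · rintro ⟨w, hw, h1, h2⟩
      have hr : w ∈ Set.range ((lineF S (v0 ++ v)).orderEmbOfFin rfl) := by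
        rw [Finset.range_orderEmbOfFin]; exact (mem_lineF hΓ _ _).2 hw
      obtain ⟨s, rfl⟩ := hr
      rw [lexLt_iff_lt, OrderEmbedding.lt_iff_lt, Fin.lt_def] at h1 h2
      simp only at h1 h2
      omega
  · intro i u β
    have h1 := hzS i (u ++ [β])
    rw [hzsucc] at h1 ⊢
    exact (hΓ.2.2.1 _ _ _ _ h1).2

end

/-- Let `Γ` be a round tree graph with horizontal branching in `[2,H]`
and vertical branching `V ≥ 2`, and `Q = 1 + log V / log H`.  For every `1 ≤ p < Q`
there exist `c > 0` and `r₀ ≥ 1` such that `Λ^p_Γ(r) ≥ c r^((pQ-p)/(pQ-p+Q))` for all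
`r ≥ r₀`.  (In particular, for `p = 1`, `Λ^1_Γ(r) ≥ c r^((Q-1)/(2Q-1))`.) -/
theorem roundTree_profile_lower (H V : ℕ) (hH : 2 ≤ H) (hV : 2 ≤ V)
    (S : Set (RTVert H V)) (Γ : SimpleGraph (RTVert H V))
    (hΓ : IsRoundTreeGraph H V S Γ)
    (p : ℝ) (hp : 1 ≤ p) (hpQ : p < 1 + Real.log V / Real.log H) :
    ∃ c > 0, ∃ r₀ : ℝ, 1 ≤ r₀ ∧ ∀ r : ℝ, r₀ ≤ r →
      c * r ^ ((p * (1 + Real.log V / Real.log H) - p) /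
          (p * (1 + Real.log V / Real.log H) - p + (1 + Real.log V / Real.log H)))
        ≤ poincareProfile Γ p r := by
  classical
  obtain ⟨K, hK, hpoin⟩ := skel_poincare V hV p hp
  have hp0 : 0 < p := by linarith
  have hH' : (2 : ℝ) ≤ H := by exact_mod_cast hH
  have hV' : (2 : ℝ) ≤ V := by exact_mod_cast hV
  have hH0 : (0 : ℝ) < H := by linarith
  have hV0 : (0 : ℝ) < V := by linarith
  have hlH : 0 < Real.log H := Real.log_pos (by linarith)
  have hlV : 0 < Real.log V := Real.log_pos (by linarith)
  set θ : ℝ := (p * (1 + Real.log V / Real.log H) - p) /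
          (p * (1 + Real.log V / Real.log H) - p + (1 + Real.log V / Real.log H)) with hθ
  have hθe : θ = p * Real.log V / (p * Real.log V + Real.log H + Real.log V) := by
    have e1 : p * (1 + Real.log V / Real.log H) - p = p * Real.log V / Real.log H := by ring
    have e2 : p * Real.log V / Real.log H + (1 + Real.log V / Real.log H) =
      (p * Real.log V + Real.log H + Real.log V) / Real.log H := by field_simp; ring
    rw [hθ, e1, e2, div_div_div_cancel_right₀ hlH.ne']
  have hθ0 : 0 ≤ θ := by rw [hθe]; positivity
  set a : ℝ := ((H : ℝ) * V) ^ (1 / p) with ha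
  have ha0 : 0 < a := by positivity
  have hap : a ^ p = H * V := by
    rw [ha, ← Real.rpow_mul (by positivity), one_div, inv_mul_cancel₀ hp0.ne', Real.rpow_one]
  have hla : Real.log a = (Real.log H + Real.log V) / p := by
    rw [ha, Real.log_rpow (by positivity), Real.log_mul hH0.ne' hV0.ne']; ring
  have haH : (H : ℝ) ≤ a := by
    rw [← Real.log_le_log_iff hH0 ha0, hla, le_div_iff₀ hp0]
    have : p * Real.log H < (1 + Real.log V / Real.log H) * Real.log H := by gcongr
    rw [add_mul, div_mul_cancel₀ _ hlH.ne'] at this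
    linarith
  set b : ℝ := a * V with hb
  have hb0 : 0 < b := by positivity
  have hb4 : 4 ≤ b := by rw [hb]; nlinarith
  have hbθ : b ^ θ = V := by
    apply Real.log_injOn_pos (Set.mem_Ioi.2 (by positivity)) (Set.mem_Ioi.2 hV0)
    rw [Real.log_rpow hb0, hb, Real.log_mul ha0.ne' hV0.ne', hla, hθe]
    field_simp
    ring
  set κ : ℝ := (2 * K) ^ (-(1 / p)) with hκ
  have hκ0 : 0 < κ := by positivity
  refine ⟨κ / 2 / (3 ^ θ * V), by positivity, 3 * b, by linarith, ?_⟩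
  intro r hr
  obtain ⟨k, hk1, hk2⟩ := exists_nat_pow_near (x := r / 3) (y := b) (by linarith) (by linarith)
  have hk : 1 ≤ k := by
    by_contra h0
    have : k = 0 := by omega
    subst this
    rw [zero_add, pow_one] at hk2
    linarith
  set M : ℕ := ⌊(a / H) ^ k⌋₊ with hM
  have hak : 1 ≤ (a / H) ^ k := one_le_pow₀ ((one_le_div hH0).2 haH)
  have hM1 : 1 ≤ M := by rw [hM, Nat.one_le_floor_iff]; exact hak
  have hMle : (M : ℝ) ≤ (a / H) ^ k := Nat.floor_le (by positivity)
  have hMge : (a / H) ^ k / 2 ≤ M := by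
    have h1 := Nat.lt_floor_add_one ((a / H) ^ k)
    have h2 : (1 : ℝ) ≤ M := by exact_mod_cast hM1
    rw [← hM] at h1
    linarith
  obtain ⟨x, z, h1, h2, h3, h4, h5⟩ := roundTree_skel hH hV hΓ k M
  set m : ℕ := M * H ^ k with hm
  have hHk : 0 < H ^ k := pow_pos (by omega) _
  have hMm : M ≤ m := Nat.le_mul_of_pos_right _ hHk
  have hmc : (m : ℝ) = M * (H : ℝ) ^ k := by rw [hm]; push_cast; rfl
  have hHk' : (0 : ℝ) < (H : ℝ) ^ k := by positivity
  have hMR : (0 : ℝ) < M := by exact_mod_cast hM1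
  have hmle : (m : ℝ) ≤ a ^ k := by
    rw [hmc]; rw [div_pow] at hMle
    rwa [le_div_iff₀ hHk'] at hMle
  have hmge : a ^ k / 2 ≤ m := by
    rw [hmc]
    calc a ^ k / 2 = (a / H) ^ k / 2 * (H : ℝ) ^ k := by rw [div_pow]; field_simp
      _ ≤ _ := by gcongr
  have hcge := skel_card_ge V k M m x z h2
  have hcle := skel_card_le V k M m hV x z
  have hnt : Nontrivial (skel V k M m x z) := by
    rw [← Fintype.one_lt_card_iff_nontrivial, Fintype.card_coe]
    have h6 : 2 ≤ V ^ k := hV.trans (Nat.le_self_pow (by omega) V)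
    have h7 : 1 ≤ m := hM1.trans hMm
    nlinarith
  have hP := hpoin Γ k M m hM1 hMm x z h1 h2 h3 h4 h5 hnt
  set s := skel V k M m x z with hs
  set G := Γ.comap (Subtype.val : s → RTVert H V) with hG
  have hVk : (0 : ℝ) < (V : ℝ) ^ k := by positivity
  have hcard : (s.card : ℝ) ≤ r := by
    have h6 : (M : ℝ) ≤ m := by exact_mod_cast hMm
    calc (s.card : ℝ) ≤ _ := hcle
      _ ≤ (V : ℝ) ^ k * a ^ k + a ^ k * (2 * (V : ℝ) ^ k) := by
        gcongr
        exact h6.trans hmle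
      _ = 3 * b ^ k := by rw [hb, mul_pow]; ring
      _ ≤ r := by linarith
  have hcardge : b ^ k / 2 ≤ s.card := by
    have h6 : (V : ℝ) ^ k * m ≤ s.card := by exact_mod_cast hcge
    refine le_trans ?_ h6
    calc b ^ k / 2 = (V : ℝ) ^ k * (a ^ k / 2) := by rw [hb, mul_pow]; ring
      _ ≤ _ := by gcongr
  have hhge : κ * (a ^ k)⁻¹ ≤ poincareConst G p := by
    refine le_trans ?_ hP
    have h6 : (m : ℝ) ^ p + (m / M : ℝ) * (V : ℝ) ^ k ≤ 2 * ((H : ℝ) * V) ^ k := by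
      have h7 : (m / M : ℝ) = (H : ℝ) ^ k := by rw [hmc]; field_simp
      have h8 : (m : ℝ) ^ p ≤ ((H : ℝ) * V) ^ k := by
        calc (m : ℝ) ^ p ≤ (a ^ k) ^ p := Real.rpow_le_rpow (by positivity) hmle hp0.le
          _ = (a ^ p) ^ k := by
            rw [← Real.rpow_natCast, ← Real.rpow_natCast, ← Real.rpow_mul ha0.le,
              ← Real.rpow_mul ha0.le, mul_comm]
          _ = _ := by rw [hap]
      rw [h7, ← mul_pow]; linarith
    have h9 : κ * (a ^ k)⁻¹ = (K * (2 * ((H : ℝ) * V) ^ k)) ^ (-(1 / p)) := by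
      have e1 : K * (2 * ((H : ℝ) * V) ^ k) = (2 * K) * ((H : ℝ) * V) ^ k := by ring
      rw [e1, Real.mul_rpow (by positivity) (by positivity), ← hκ]
      congr 1
      rw [Real.rpow_neg (by positivity), ha, ← Real.rpow_natCast, ← Real.rpow_natCast,
        ← Real.rpow_mul (by positivity), ← Real.rpow_mul (by positivity), mul_comm (1 / p)]
    rw [h9]
    apply Real.rpow_le_rpow_of_nonpos
    · positivity
    · gcongr
    · have : 0 < 1 / p := by positivity
      linarith
  have hval : κ / 2 * (V : ℝ) ^ k ≤ (s.card : ℝ) * poincareConst G p := by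
    calc κ / 2 * (V : ℝ) ^ k = (b ^ k / 2) * (κ * (a ^ k)⁻¹) := by
          rw [hb, mul_pow]; field_simp
      _ ≤ _ := by gcongr
  have hrθ : r ^ θ ≤ 3 ^ θ * V * (V : ℝ) ^ k := by
    have hr3 : r ≤ 3 * b ^ (k + 1) := by linarith
    calc r ^ θ ≤ (3 * b ^ (k + 1)) ^ θ := Real.rpow_le_rpow (by linarith) hr3 hθ0
      _ = 3 ^ θ * (b ^ θ) ^ (k + 1) := by
        rw [Real.mul_rpow (by norm_num) (by positivity), ← Real.rpow_natCast,
          ← Real.rpow_natCast, ← Real.rpow_mul hb0.le, ← Real.rpow_mul hb0.le, mul_comm θ]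
      _ = _ := by rw [hbθ, pow_succ]; ring
  calc κ / 2 / (3 ^ θ * V) * r ^ θ ≤ κ / 2 / (3 ^ θ * V) * (3 ^ θ * V * (V : ℝ) ^ k) := by gcongr
    _ = κ / 2 * (V : ℝ) ^ k := by field_simp
    _ ≤ _ := hval
    _ ≤ poincareProfile Γ p r := by
      apply le_csSup (profile_bdd Γ hp r)
      exact ⟨s, G, fun u v h => h, hcard, rfl⟩
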